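/- For all natural numbers α, μ with 1 ≤ α ≤ μ one has the recursion T^{μ}_{α} = q^{2(μ−α+1)}·T^{μ−1}_{α−1} − (q^{2(μ−α+1)} − 1)·T^{μ}_{α−1} in ℚ(q). -/

import Mathlib

/-- The variable `q` in the field `ℚ(q)` of rational functions. -/
noncomputable def qq : RatFunc ℚ := RatFunc.X

/-- The quantum integer `[m] = ∑_{s=0}^{m-1} q^{m-1-2s} = (q^m - q^{-m})/(q - q^{-1})`. -/
noncomputable def qint (m : ℕ) : RatFunc ℚ :=
  ∑ s ∈ Finset.range m, qq ^ ((m : ℤ) - 1 - 2 * (s : ℤ))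

/-- The quantum factorial `[m]! = [m][m-1]⋯[1]`. -/
noncomputable def qfact (m : ℕ) : RatFunc ℚ :=
  ∏ r ∈ Finset.range m, qint (r + 1)

/-- The quantum binomial coefficient `[m]!/([a]![m-a]!)`. -/
noncomputable def qbinom (m a : ℕ) : RatFunc ℚ :=
  qfact m / (qfact a * qfact (m - a))

/-- The sum `T^μ_α` appearing in the computation of the `R`-matrix action on
highest weight vectors. -/
noncomputable def Tsum (μ α : ℕ) : RatFunc ℚ :=
  qq ^ (α * (μ - α + 1)) *
    ∑ n ∈ Finset.range (α + 1),
      (-1) ^ n * qbinom α n * (∏ s ∈ Finset.range n, qint (μ - α + (s + 1))) *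
        qq ^ ((α - n) * (μ - α + n + 1) + n * (n - 1) / 2) * (qq - qq⁻¹) ^ n

theorem qq_ne_zero : qq ≠ 0 := RatFunc.X_ne_zero

theorem qq_pow_ne_one {n : ℕ} (hn : n ≠ 0) : qq ^ n ≠ 1 := by
  intro h
  have h' : algebraMap (Polynomial ℚ) (RatFunc ℚ) (Polynomial.X ^ n)
      = algebraMap (Polynomial ℚ) (RatFunc ℚ) 1 := by
    rw [map_pow, RatFunc.algebraMap_X, map_one]
    exact h
  have h2 := congrArg Polynomial.natDegree (RatFunc.algebraMap_injective ℚ h')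
  simp only [Polynomial.natDegree_X_pow, Polynomial.natDegree_one] at h2
  exact hn h2

theorem qq_sub_inv_ne_zero : qq - qq⁻¹ ≠ 0 := by
  intro h
  apply qq_pow_ne_one two_ne_zero
  have h0 := qq_ne_zero
  field_simp at h
  linear_combination h

theorem qint_succ (m : ℕ) : qint (m + 1) = qq * qint m + (qq ^ m)⁻¹ := by
  have h0 := qq_ne_zero
  unfold qint
  rw [Finset.sum_range_succ, Finset.mul_sum]
  congr 1
  · refine Finset.sum_congr rfl fun s _ => ?_
    rw [← zpow_one_add₀ h0]
    congr 1
    push_cast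
    ring
  · rw [← zpow_natCast, ← zpow_neg]
    congr 1
    push_cast
    ring

theorem qint_mul_sub_inv (m : ℕ) : qint m * (qq - qq⁻¹) = qq ^ m - (qq ^ m)⁻¹ := by
  have h0 := qq_ne_zero
  induction m with
  | zero => simp [qint]
  | succ m ih =>
    have hm : qq ^ m ≠ 0 := pow_ne_zero _ h0
    rw [qint_succ, add_mul, mul_assoc, ih]
    field_simp
    ring

theorem qint_ne_zero {m : ℕ} (hm : m ≠ 0) : qint m ≠ 0 := by
  intro h
  have h1 := qint_mul_sub_inv m
  have h0 : qq ^ m ≠ 0 := pow_ne_zero _ qq_ne_zero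
  rw [h, zero_mul] at h1
  apply qq_pow_ne_one (mul_ne_zero hm two_ne_zero)
  rw [pow_mul]
  field_simp at h1
  linear_combination -h1

theorem qfact_ne_zero (m : ℕ) : qfact m ≠ 0 :=
  Finset.prod_ne_zero_iff.2 fun r _ => qint_ne_zero r.succ_ne_zero

theorem qfact_succ (m : ℕ) : qfact (m + 1) = qfact m * qint (m + 1) :=
  Finset.prod_range_succ _ _

theorem qint_add (a b : ℕ) : qq ^ b * qint (a + b) = qint a + qq ^ (a + b) * qint b := by
  have ha : qq ^ a ≠ 0 := pow_ne_zero _ qq_ne_zero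
  have hb : qq ^ b ≠ 0 := pow_ne_zero _ qq_ne_zero
  apply mul_right_cancel₀ qq_sub_inv_ne_zero
  rw [mul_assoc, add_mul, mul_assoc, qint_mul_sub_inv, qint_mul_sub_inv, qint_mul_sub_inv, pow_add]
  field_simp
  ring

/-- The Gaussian binomial coefficient in the variable `q²`, defined by the Pascal recursion. -/
noncomputable def gaussBinom : ℕ → ℕ → RatFunc ℚ
  | _, 0 => 1
  | 0, _ + 1 => 0
  | a + 1, n + 1 => gaussBinom a (n + 1) + qq ^ (2 * (a - n)) * gaussBinom a n

theorem gaussBinom_zero_right (a : ℕ) : gaussBinom a 0 = 1 := by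
  cases a <;> rfl

theorem gaussBinom_succ_succ (a n : ℕ) : gaussBinom (a + 1) (n + 1) =
    gaussBinom a (n + 1) + qq ^ (2 * (a - n)) * gaussBinom a n := rfl

theorem gaussBinom_of_lt {a n : ℕ} (h : a < n) : gaussBinom a n = 0 := by
  induction a generalizing n with
  | zero =>
    obtain ⟨n, rfl⟩ := Nat.exists_eq_succ_of_ne_zero h.ne'
    rfl
  | succ a ih =>
    obtain ⟨n, rfl⟩ := Nat.exists_eq_succ_of_ne_zero (by omega : n ≠ 0)
    rw [Nat.succ_eq_add_one, gaussBinom_succ_succ, ih (by omega), ih (by omega), mul_zero, add_zero]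

theorem gaussBinom_self (n : ℕ) : gaussBinom n n = 1 := by
  induction n with
  | zero => rfl
  | succ n ih => simp [gaussBinom_succ_succ, gaussBinom_of_lt, ih]

theorem gaussBinom_mul_qfact (m n : ℕ) :
    gaussBinom (m + n) n * (qfact n * qfact m) = qq ^ (m * n) * qfact (m + n) := by
  induction n generalizing m with
  | zero => simp [gaussBinom_zero_right, qfact]
  | succ n ihn =>
    induction m with
    | zero => simp [gaussBinom_self, qfact]
    | succ m ihm =>
      have h1 := ihn (m + 1)
      have h2 := qint_add (m + 1) (n + 1)
      rw [← add_assoc] at ihm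
      rw [show m + 1 + n = m + n + 1 by ring] at h1
      rw [show m + 1 + (n + 1) = m + n + 1 + 1 by ring] at h2 ⊢
      rw [gaussBinom_succ_succ, show m + n + 1 - n = m + 1 by omega, qfact_succ (m + n + 1)]
      rw [qfact_succ n] at ihm ⊢
      rw [qfact_succ m] at h1 ⊢
      linear_combination qint (m + 1) * ihm + qq ^ (2 * (m + 1)) * qint (n + 1) * h1
        - qq ^ (m * (n + 1)) * qfact (m + n + 1) * h2

theorem qbinom_mul_qq_pow (m n : ℕ) :
    qbinom (m + n) n * qq ^ (m * n) = gaussBinom (m + n) n := by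
  have hn := qfact_ne_zero n
  have hm := qfact_ne_zero m
  rw [qbinom, Nat.add_sub_cancel]
  field_simp
  linear_combination -gaussBinom_mul_qfact m n

/-- The shifted factorial `∏_{i < n} (q^{2(k+1+i)} - 1)`. -/
noncomputable def qshift (k n : ℕ) : RatFunc ℚ :=
  ∏ i ∈ Finset.range n, (qq ^ (2 * (k + 1 + i)) - 1)

theorem prod_qint_mul (k n : ℕ) :
    (∏ s ∈ Finset.range n, qint (k + (s + 1))) * (qq - qq⁻¹) ^ n *
      qq ^ (n * (k + 1) + n * (n - 1) / 2) = qshift k n := by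
  induction n with
  | zero => simp [qshift]
  | succ n ih =>
    have h : (n + 1) * (n + 1 - 1) / 2 = n * (n - 1) / 2 + n := by
      rw [← Nat.choose_two_right, ← Nat.choose_two_right, Nat.choose_succ_succ' n 1,
        Nat.choose_one_right, add_comm]
    have hq : qq ^ (k + (n + 1)) ≠ 0 := pow_ne_zero _ qq_ne_zero
    have h2 : qint (k + (n + 1)) * (qq - qq⁻¹) * qq ^ (k + (n + 1))
        = qq ^ (2 * (k + 1 + n)) - 1 := by
      rw [qint_mul_sub_inv, sub_mul, inv_mul_cancel₀ hq]
      ring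
    have h3 : qshift k (n + 1) = qshift k n * (qq ^ (2 * (k + 1 + n)) - 1) :=
      Finset.prod_range_succ _ _
    rw [h3, ← ih, ← h2, h, Finset.prod_range_succ,
      pow_succ (qq - qq⁻¹),
      show (n + 1) * (k + 1) + (n * (n - 1) / 2 + n)
        = (n * (k + 1) + n * (n - 1) / 2) + (k + (n + 1)) by ring, pow_add qq (n * (k + 1) + _)]
    ring

theorem qshift_succ_left (k n : ℕ) :
    qshift k (n + 1) = (qq ^ (2 * (k + 1)) - 1) * qshift (k + 1) n := by
  rw [qshift, Finset.prod_range_succ', mul_comm, qshift]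
  congr 1
  refine Finset.prod_congr rfl fun i _ => ?_
  congr 2
  ring

theorem Tsum_add_left (k a : ℕ) : Tsum (k + a) a = ∑ n ∈ Finset.range (a + 1),
    (-1) ^ n * gaussBinom a n * qq ^ (2 * (k + 1) * (a - n)) * qshift k n := by
  rw [Tsum, Nat.add_sub_cancel, Finset.mul_sum]
  refine Finset.sum_congr rfl fun n hn => ?_
  obtain ⟨m, rfl⟩ := Nat.exists_eq_add_of_le' (Nat.lt_succ_iff.1 (Finset.mem_range.1 hn))
  rw [Nat.add_sub_cancel, ← prod_qint_mul, ← qbinom_mul_qq_pow]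
  generalize n * (n - 1) / 2 = t
  ring

theorem Tsum_add_succ (k a : ℕ) : Tsum (k + (a + 1)) (a + 1) =
    qq ^ (2 * (k + 1)) * Tsum (k + a) a
      - (qq ^ (2 * (k + 1)) - 1) * Tsum (k + 1 + a) a := by
  have hext : Tsum (k + a) a = ∑ n ∈ Finset.range (a + 1 + 1),
      (-1) ^ n * gaussBinom a n * qq ^ (2 * (k + 1) * (a - n)) * qshift k n := by
    rw [Finset.sum_range_succ, gaussBinom_of_lt a.lt_succ_self, Tsum_add_left]
    ring
  rw [hext, Tsum_add_left, Tsum_add_left, Finset.sum_range_succ', Finset.sum_range_succ' _ (a + 1),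
    mul_add (qq ^ (2 * (k + 1))) (Finset.sum _ _), Finset.mul_sum, Finset.mul_sum, add_sub_right_comm, ← Finset.sum_sub_distrib]
  congr 1
  · refine Finset.sum_congr rfl fun n hn => ?_
    rw [qshift_succ_left, gaussBinom_succ_succ, Nat.add_sub_add_right]
    rcases (Nat.lt_succ_iff.1 (Finset.mem_range.1 hn)).eq_or_lt with rfl | hlt
    · rw [gaussBinom_of_lt n.lt_succ_self, Nat.sub_self]
      ring
    · obtain ⟨m, rfl⟩ := Nat.exists_eq_add_of_lt hlt
      rw [show n + m + 1 - n = m + 1 by omega, show n + m + 1 - (n + 1) = m by omega]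
      ring
  · simp only [gaussBinom_zero_right, Nat.sub_zero]
    ring

/-- The recursion `T^μ_α = q^{2(μ-α+1)} T^{μ-1}_{α-1} - (q^{2(μ-α+1)} - 1) T^μ_{α-1}`. -/
theorem Tsum_recursion (μ α : ℕ) (h1 : 1 ≤ α) (h2 : α ≤ μ) :
    Tsum μ α = qq ^ (2 * (μ - α + 1)) * Tsum (μ - 1) (α - 1)
      - (qq ^ (2 * (μ - α + 1)) - 1) * Tsum μ (α - 1) := by
  obtain ⟨a, rfl⟩ := Nat.exists_eq_add_of_le' h1
  obtain ⟨k, rfl⟩ := Nat.exists_eq_add_of_le' h2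
  rw [Nat.add_sub_cancel, Nat.add_sub_cancel, ← add_assoc, Nat.add_sub_cancel, add_assoc,
    Tsum_add_succ, add_right_comm, add_assoc]
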